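/- arXiv:2009.10655 — 4 statements merged into one kernel-verified Lean document; each statement's English description precedes it below -/
import Mathlib

section
/- For every positive integer n, the sequences (P^B_{n,k})_{k=0}^{n} and (Q^B_{n,k})_{k=0}^{n} are ratio-alternating; specifically, P^B_{n,k} ≥ Q^B_{n,k} for all even k with 0 ≤ k ≤ n, and P^B_{n,k} ≤ Q^B_{n,k} for all odd k with 0 ≤ k ≤ n. -/
/-- An element of the hyperoctahedral group `B_n`, encoded as a pair `(σ, ε)` of a
permutation of `Fin n` and a sign vector: the corresponding signed permutation sends
`i+1` (for `i : Fin n`) to `±(σ(i)+1)`, and `-(i+1)` to `∓(σ(i)+1)`. -/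
abbrev SignedPerm (n : ℕ) := Equiv.Perm (Fin n) × (Fin n → Bool)

/-- The value `π(i+1) ∈ {-n,…,-1,1,…,n}` of the signed permutation at `i+1`. -/
def valB {n : ℕ} (p : SignedPerm n) (i : Fin n) : ℤ :=
  if p.2 i then -((p.1 i : ℤ) + 1) else (p.1 i : ℤ) + 1

/-- The signed permutation as a function on `ℤ` (value `0` outside `{-n,…,-1,1,…,n}`;
in particular `π(0) = 0`). -/
def appB {n : ℕ} (p : SignedPerm n) (x : ℤ) : ℤ :=
  if h : 1 ≤ x ∧ x ≤ (n : ℤ) then valB p ⟨x.toNat - 1, by omega⟩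
  else if h' : 1 ≤ -x ∧ -x ≤ (n : ℤ) then -(valB p ⟨(-x).toNat - 1, by omega⟩)
  else 0

/-- Type B inversions:
`inv_B(π) = |{i<j : π(i)>π(j)}| + |{i<j : -π(i)>π(j)}| + |{i : π(i)<0}|`. -/
def invB {n : ℕ} (p : SignedPerm n) : ℕ :=
  (Finset.univ.filter (fun ij : Fin n × Fin n =>
      ij.1 < ij.2 ∧ valB p ij.1 > valB p ij.2)).card +
  (Finset.univ.filter (fun ij : Fin n × Fin n =>
      ij.1 < ij.2 ∧ -valB p ij.1 > valB p ij.2)).card +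
  (Finset.univ.filter (fun i : Fin n => valB p i < 0)).card

/-- Type B excedances (Brenti):
`exc_B(π) = |{i ∈ [n] : π(|π(i)|) > π(i)}| + |{i ∈ [n] : π(i) = -i}|`. -/
def excB {n : ℕ} (p : SignedPerm n) : ℕ :=
  (Finset.univ.filter (fun i : Fin n => appB p |valB p i| > valB p i)).card +
  (Finset.univ.filter (fun i : Fin n => valB p i = -((i : ℤ) + 1))).card

/-- Type B descents (with the convention `π(0) = 0`):
`des_B(π) = |{i ∈ {0,…,n-1} : π(i) > π(i+1)}|`. -/
def desB {n : ℕ} (p : SignedPerm n) : ℕ :=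
  (Finset.univ.filter (fun i : Fin n => appB p (i : ℤ) > appB p ((i : ℤ) + 1))).card

/-- `PB n k`: number of elements of `B_n^+` (even `inv_B`) with `k` type B excedances. -/
def PB (n k : ℕ) : ℕ :=
  (Finset.univ.filter (fun p : SignedPerm n => Even (invB p) ∧ excB p = k)).card

/-- `QB n k`: number of elements of `B_n^-` (odd `inv_B`) with `k` type B excedances. -/
def QB (n k : ℕ) : ℕ :=
  (Finset.univ.filter (fun p : SignedPerm n => ¬ Even (invB p) ∧ excB p = k)).card

/-- `Bp n k`: number of elements of `B_n^+` with `k` type B descents. -/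
def Bp (n k : ℕ) : ℕ :=
  (Finset.univ.filter (fun p : SignedPerm n => Even (invB p) ∧ desB p = k)).card

/-- `Bm n k`: number of elements of `B_n^-` with `k` type B descents. -/
def Bm (n k : ℕ) : ℕ :=
  (Finset.univ.filter (fun p : SignedPerm n => ¬ Even (invB p) ∧ desB p = k)).card

theorem abs_valB {n : ℕ} (p : SignedPerm n) (i : Fin n) : |valB p i| = (p.1 i : ℤ) + 1 := by
  unfold valB
  split_ifs
  · rw [abs_neg, abs_of_nonneg (by positivity)]
  · exact abs_of_nonneg (by positivity)

theorem appB_abs_valB {n : ℕ} (p : SignedPerm n) (i : Fin n) :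
    appB p |valB p i| = valB p (p.1 i) := by
  have hlt := (p.1 i).isLt
  rw [abs_valB]
  unfold appB
  rw [dif_pos (by omega)]
  congr 1

/-- Modulo two, `invB` is the inversion number of the underlying permutation plus the number
of negative entries. -/
theorem even_invB_iff {n : ℕ} (p : SignedPerm n) :
    Even (invB p) ↔
      Even ((Finset.univ.filter (fun ij : Fin n × Fin n =>
        ij.1 < ij.2 ∧ p.1 ij.1 > p.1 ij.2)).card +
        (Finset.univ.filter (fun i : Fin n => p.2 i = true)).card) := by
  have hneg : (Finset.univ.filter (fun i : Fin n => valB p i < 0)) =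
      Finset.univ.filter (fun i : Fin n => p.2 i = true) := by
    refine Finset.filter_congr fun i _ => ?_
    unfold valB
    split_ifs with h <;> simp only [h] <;> constructor <;> intro h' <;>
      first | omega | simp_all
  have hinv : (Finset.univ.filter (fun ij : Fin n × Fin n =>
        ij.1 < ij.2 ∧ valB p ij.1 > valB p ij.2)).card +
      (Finset.univ.filter (fun ij : Fin n × Fin n =>
        ij.1 < ij.2 ∧ -valB p ij.1 > valB p ij.2)).card =
      (Finset.univ.filter (fun ij : Fin n × Fin n =>
        ij.1 < ij.2 ∧ p.1 ij.1 > p.1 ij.2)).card +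
      2 * (Finset.univ.filter (fun ij : Fin n × Fin n =>
        ij.1 < ij.2 ∧ p.1 ij.1 < p.1 ij.2 ∧ p.2 ij.2 = true)).card := by
    simp only [Finset.card_filter, Finset.mul_sum, ← Finset.sum_add_distrib]
    refine Finset.sum_congr rfl fun ij _ => ?_
    obtain ⟨i, j⟩ := ij
    by_cases hij : i < j
    · have hne : (p.1 i : ℕ) ≠ p.1 j := fun h => hij.ne (p.1.injective (Fin.ext h))
      simp only [hij, true_and, valB, gt_iff_lt, Fin.lt_def]
      cases p.2 i <;> cases p.2 j <;>
        simp only [if_true, if_false, Bool.false_eq_true, and_true, and_false] <;>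
        split_ifs <;> omega
    · simp [hij]
  unfold invB
  rw [hinv, hneg, add_right_comm, Nat.even_add, iff_true_right (even_two_mul _)]

/-- The signed permutation with the sign at `j` reversed. -/
def flipSign {n : ℕ} (p : SignedPerm n) (j : Fin n) : SignedPerm n :=
  (p.1, Function.update p.2 j (!p.2 j))

theorem flipSign_flipSign {n : ℕ} (p : SignedPerm n) (j : Fin n) :
    flipSign (flipSign p j) j = p := by
  simp [flipSign]

theorem valB_flipSign_self {n : ℕ} (p : SignedPerm n) (j : Fin n) :
    valB (flipSign p j) j = -valB p j := by
  unfold valB flipSign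
  cases p.2 j <;> simp

theorem valB_flipSign_of_ne {n : ℕ} (p : SignedPerm n) {i j : Fin n} (h : i ≠ j) :
    valB (flipSign p j) i = valB p i := by
  simp [valB, flipSign, h]

theorem even_invB_flipSign {n : ℕ} (p : SignedPerm n) (j : Fin n) :
    Even (invB (flipSign p j)) ↔ ¬ Even (invB p) := by
  have hcard : Even (Finset.univ.filter (fun i : Fin n => (flipSign p j).2 i = true)).card ↔
      ¬ Even (Finset.univ.filter (fun i : Fin n => p.2 i = true)).card := by
    simp only [Finset.card_filter]
    rw [← Finset.add_sum_erase _ _ (Finset.mem_univ j),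
      ← Finset.add_sum_erase Finset.univ (fun i => if p.2 i = true then 1 else 0)
        (Finset.mem_univ j)]
    have hrest : ∑ i ∈ Finset.univ.erase j, (if (flipSign p j).2 i = true then 1 else 0) =
        ∑ i ∈ Finset.univ.erase j, (if p.2 i = true then 1 else 0) := by
      refine Finset.sum_congr rfl fun i hi => ?_
      simp [flipSign, Finset.ne_of_mem_erase hi]
    rw [hrest]
    cases h : p.2 j <;> simp [flipSign, h, Nat.even_add]
  rw [even_invB_iff, even_invB_iff, Nat.even_add, Nat.even_add, hcard]
  simp only [flipSign]
  tauto

/-- Reversing the sign at an excedance `j` of the underlying permutation whose image is an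
anti-excedance exchanges the contributions of `j` and its preimage to `excB`. -/
theorem excB_flipSign {n : ℕ} (p : SignedPerm n) {j : Fin n} (h₁ : j < p.1 j)
    (h₂ : p.1 (p.1 j) < p.1 j) : excB (flipSign p j) = excB p := by
  have hfix : ∀ i, p.1 i = i → i ≠ j := fun i hi hij => by
    subst hij
    exact h₁.ne hi.symm
  unfold excB
  congr 1
  · refine Finset.card_equiv (Equiv.swap j (p.1.symm j)) fun i => ?_
    simp only [Finset.mem_filter, Finset.mem_univ, true_and, appB_abs_valB]
    have hσ : (flipSign p j).1 = p.1 := rfl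
    rw [hσ]
    have hk : p.1 (p.1.symm j) = j := p.1.apply_symm_apply j
    have hkj : p.1.symm j ≠ j := fun h => h₁.ne (by rw [h] at hk; exact hk.symm)
    generalize p.1.symm j = k at hk hkj
    have hvj : valB p j = (p.1 j : ℤ) + 1 ∨ valB p j = -((p.1 j : ℤ) + 1) := by
      unfold valB; split_ifs <;> simp
    have hvk := abs_le.mp (abs_valB p k).le
    have hvm := abs_le.mp (abs_valB p (p.1 j)).le
    rw [hk] at hvk
    rw [Fin.lt_def] at h₁ h₂
    by_cases hij : i = j
    · subst hij
      rw [Equiv.swap_apply_left, valB_flipSign_self, hk,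
        valB_flipSign_of_ne p (Fin.ne_of_gt h₁)]
      omega
    by_cases hik : i = k
    · subst hik
      rw [Equiv.swap_apply_right, hk, valB_flipSign_self, valB_flipSign_of_ne p hij]
      omega
    · have hσi : p.1 i ≠ j := fun h => hik (p.1.injective (h.trans hk.symm))
      rw [Equiv.swap_apply_of_ne_of_ne hij hik, valB_flipSign_of_ne p hij,
        valB_flipSign_of_ne p hσi]
  · congr 1
    refine Finset.filter_congr fun i _ => ?_
    by_cases hij : i = j
    · have := Fin.lt_def.mp h₁
      subst hij
      rw [valB_flipSign_self]
      unfold valB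
      split_ifs <;> omega
    · rw [valB_flipSign_of_ne p hij]

/-- A nontrivial permutation has an excedance whose image is an anti-excedance. -/
theorem exists_lt_apply_and_apply_apply_lt {α : Type*} [LinearOrder α] [Fintype α]
    {σ : Equiv.Perm α} (hσ : σ ≠ 1) : ∃ j, j < σ j ∧ σ (σ j) < σ j := by
  have hne : σ.support.Nonempty := by
    rwa [Finset.nonempty_iff_ne_empty, ne_eq, Equiv.Perm.support_eq_empty_iff]
  set m := σ.support.max' hne with hm
  have hmem : m ∈ σ.support := σ.support.max'_mem hne
  have hle : ∀ i ∈ σ.support, i ≤ m := fun i hi => σ.support.le_max' i hi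
  have hmove : σ m ≠ m := Equiv.Perm.mem_support.mp hmem
  refine ⟨σ.symm m, ?_, ?_⟩ <;> rw [Equiv.apply_symm_apply]
  · refine lt_of_le_of_ne (hle _ ?_) fun h => ?_
    · rwa [← Equiv.Perm.apply_mem_support, Equiv.apply_symm_apply]
    · exact hmove (σ.symm_apply_eq.mp h).symm
  · exact lt_of_le_of_ne (hle _ (Equiv.Perm.apply_mem_support.mpr hmem)) hmove

open Classical in
/-- Reverse the sign at a chosen excedance followed by an anti-excedance, if there is one. -/
noncomputable def flipPeak {n : ℕ} (p : SignedPerm n) : SignedPerm n :=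
  if h : p.1 ≠ 1 then flipSign p (exists_lt_apply_and_apply_apply_lt h).choose else p

theorem flipPeak_involutive {n : ℕ} : Function.Involutive (flipPeak (n := n)) := by
  intro p
  by_cases h : p.1 ≠ 1
  · have h' : (flipPeak p).1 ≠ 1 := by simp [flipPeak, h, flipSign]
    rw [flipPeak, dif_pos h']
    simp only [flipPeak, dif_pos h]
    exact flipSign_flipSign p _
  · simp [flipPeak, h]

theorem excB_flipPeak {n : ℕ} (p : SignedPerm n) : excB (flipPeak p) = excB p := by
  unfold flipPeak
  split_ifs with h
  · exact excB_flipSign p (exists_lt_apply_and_apply_apply_lt h).choose_spec.1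
      (exists_lt_apply_and_apply_apply_lt h).choose_spec.2
  · rfl

theorem even_invB_flipPeak {n : ℕ} {p : SignedPerm n} (h : p.1 ≠ 1) :
    Even (invB (flipPeak p)) ↔ ¬ Even (invB p) := by
  rw [flipPeak, dif_pos h]
  exact even_invB_flipSign p _

theorem even_invB_iff_even_excB {n : ℕ} {p : SignedPerm n} (h : p.1 = 1) :
    Even (invB p) ↔ Even (excB p) := by
  have h₁ : (Finset.univ.filter (fun ij : Fin n × Fin n =>
      ij.1 < ij.2 ∧ p.1 ij.1 > p.1 ij.2)) = ∅ := by
    refine Finset.filter_false_of_mem fun ij _ hij => ?_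
    rw [h] at hij
    exact lt_asymm hij.1 hij.2
  have h₂ : (Finset.univ.filter (fun i : Fin n => appB p |valB p i| > valB p i)) = ∅ := by
    refine Finset.filter_false_of_mem fun i _ hi => ?_
    rw [appB_abs_valB, h] at hi
    exact lt_irrefl _ hi
  have h₃ : (Finset.univ.filter (fun i : Fin n => valB p i = -((i : ℤ) + 1))) =
      Finset.univ.filter (fun i : Fin n => p.2 i = true) := by
    refine Finset.filter_congr fun i _ => ?_
    rw [valB, h, Equiv.Perm.one_apply]
    cases p.2 i
    · simp only [Bool.false_eq_true, if_false, iff_false]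
      omega
    · simp
  rw [even_invB_iff, excB, h₁, h₂, h₃, Finset.card_empty, Finset.card_empty]

/-- **Corollary.** For every positive integer `n`, the sequences `(P^B_{n,k})_{k=0}^{n}`
and `(Q^B_{n,k})_{k=0}^{n}` are ratio-alternating: `P^B_{n,k} ≥ Q^B_{n,k}` for even `k`
and `P^B_{n,k} ≤ Q^B_{n,k}` for odd `k` (for `0 ≤ k ≤ n`). -/
theorem typeB_excedance_ratio_alternating (n : ℕ) (hn : 1 ≤ n) :
    ∀ k : ℕ, k ≤ n →
      (Even k → QB n k ≤ PB n k) ∧ (Odd k → PB n k ≤ QB n k) := by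
  refine fun k _ => ⟨fun hk => ?_, fun hk => ?_⟩ <;>
  · refine Finset.card_le_card_of_injOn flipPeak (fun p hp => ?_)
      flipPeak_involutive.injective.injOn
    simp only [Finset.coe_filter, Finset.mem_univ, true_and, Set.mem_ofPred_eq] at hp ⊢
    have hne : p.1 ≠ 1 := fun h => by
      have := even_invB_iff_even_excB h
      rw [hp.2] at this
      have := Nat.not_even_iff_odd (n := k)
      tauto
    rw [even_invB_flipPeak hne, excB_flipPeak]
    tauto
end

section
/- For every positive integer n, the sequences (P_{n,k})_{k=0}^{n-1}, (Q_{n,k})_{k=0}^{n-1}, (P^B_{n,k})_{k=0}^{n}, and (Q^B_{n,k})_{k=0}^{n} are each unimodal. -/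
/-- Number of excedances of a permutation of `{1,…,n}` (encoded on `Fin n`):
`exc σ = |{i : σ(i) > i}|`. -/
def excA {n : ℕ} (σ : Equiv.Perm (Fin n)) : ℕ :=
  (Finset.univ.filter (fun i : Fin n => i < σ i)).card

/-- `P n k`: number of even permutations of `[n]` with exactly `k` excedances. -/
def P (n k : ℕ) : ℕ :=
  (Finset.univ.filter (fun σ : Equiv.Perm (Fin n) =>
    Equiv.Perm.sign σ = 1 ∧ excA σ = k)).card

/-- `Q n k`: number of odd permutations of `[n]` with exactly `k` excedances. -/
def Q (n k : ℕ) : ℕ :=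
  (Finset.univ.filter (fun σ : Equiv.Perm (Fin n) =>
    Equiv.Perm.sign σ = -1 ∧ excA σ = k)).card

/-- A sequence `(f k)_{k=0}^m` is unimodal: there is an index `0 ≤ r ≤ m` with
`f 0 ≤ f 1 ≤ … ≤ f r ≥ f (r+1) ≥ … ≥ f m`. -/
def UnimodalOn (m : ℕ) (f : ℕ → ℕ) : Prop :=
  ∃ r : ℕ, r ≤ m ∧ (∀ k : ℕ, k < r → f k ≤ f (k + 1)) ∧
    (∀ k : ℕ, r ≤ k → k < m → f (k + 1) ≤ f k)

/-- A sequence on `{0,…,m}` which increases on the left half and decreases on the right half is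
unimodal; when `m` is odd, nothing is assumed about the two middle terms. -/
theorem unimodalOn_of_halves {m : ℕ} {f : ℕ → ℕ}
    (hinc : ∀ k, 2 * (k + 1) < m + 1 → f k ≤ f (k + 1))
    (hdec : ∀ k, m + 1 < 2 * (k + 1) → k < m → f (k + 1) ≤ f k) : UnimodalOn m f := by
  obtain ⟨c, rfl | rfl⟩ := m.even_or_odd'
  · exact ⟨c, by omega, fun k hk ↦ hinc k (by omega), fun k hk hm ↦ hdec k (by omega) hm⟩
  · rcases le_total (f c) (f (c + 1)) with h | h
    · refine ⟨c + 1, by omega, fun k hk ↦ ?_, fun k hk hm ↦ hdec k (by omega) hm⟩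
      rcases (Nat.lt_succ_iff.mp hk).eq_or_lt with rfl | hk
      · exact h
      · exact hinc k (by omega)
    · refine ⟨c, by omega, fun k hk ↦ hinc k (by omega), fun k hk hm ↦ ?_⟩
      rcases hk.eq_or_lt with rfl | hk
      · exact h
      · exact hdec k (by omega) hm

/-- The recurrence satisfied by the Eulerian numbers (`α = 1`, with `a m` the sequence for `m + 1`)
and by the type B Eulerian numbers (`α = 2`). -/
structure IsEulerian (α : ℕ) (a : ℕ → ℕ → ℤ) : Prop where
  zero_left : ∀ k, a 0 k = if k = 0 then 1 else 0
  succ_zero : ∀ m, a (m + 1) 0 = a m 0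
  succ_succ : ∀ m k, a (m + 1) (k + 1) =
    (α * (k + 1) + 1) * a m (k + 1) + (α * (m - k) + 1) * a m k

/-- Successive differences of a sequence, the first term being kept. -/
def diffSeq (f : ℕ → ℤ) : ℕ → ℤ
  | 0 => f 0
  | k + 1 => f (k + 1) - f k

namespace IsEulerian

variable {α : ℕ} {a : ℕ → ℕ → ℤ}

theorem diffSeq_succ_zero (h : IsEulerian α a) (m : ℕ) :
    diffSeq (a (m + 1)) 0 = diffSeq (a m) 0 := h.succ_zero m

theorem diffSeq_succ_succ (h : IsEulerian α a) (m k : ℕ) :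
    diffSeq (a (m + 1)) (k + 1) = (α * (k + 1) + 1) * diffSeq (a m) (k + 1) +
      (α * (m + 1 - k) + 1) * diffSeq (a m) k := by
  cases k with
  | zero => simp only [diffSeq, h.succ_succ, h.succ_zero]; push_cast; ring
  | succ k => simp only [diffSeq, h.succ_succ]; push_cast; ring

theorem diffSeq_zero (h : IsEulerian α a) (m : ℕ) : diffSeq (a m) 0 = 1 := by
  induction m with
  | zero => simp [diffSeq, h.zero_left]
  | succ m ih => rw [h.diffSeq_succ_zero, ih]

theorem diffSeq_eq_zero (h : IsEulerian α a) {m k : ℕ} (hk : m + 1 < k) : diffSeq (a m) k = 0 := by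
  induction m generalizing k with
  | zero =>
    obtain ⟨k, rfl⟩ := Nat.exists_eq_add_of_lt hk
    simp [diffSeq, h.zero_left]
  | succ m ih =>
    obtain ⟨k, rfl⟩ := Nat.exists_eq_add_of_lt hk
    rw [h.diffSeq_succ_succ, ih (by omega), ih (by omega)]
    simp

theorem diffSeq_antisymm (h : IsEulerian α a) {m i j : ℕ} (hij : i + j = m + 1) :
    diffSeq (a m) i = -diffSeq (a m) j := by
  have last : ∀ m, diffSeq (a m) (m + 1) = -1 := by
    intro m
    induction m with
    | zero => simp [diffSeq, h.zero_left]
    | succ m ih =>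
      rw [h.diffSeq_succ_succ, h.diffSeq_eq_zero (by omega), ih]
      push_cast
      ring
  induction m generalizing i j with
  | zero =>
    obtain ⟨rfl, rfl⟩ | ⟨rfl, rfl⟩ : i = 0 ∧ j = 1 ∨ i = 1 ∧ j = 0 := by omega
    · rw [last 0, h.diffSeq_zero]; rfl
    · rw [last 0, h.diffSeq_zero]
  | succ m ih =>
    rcases i with _ | i
    · obtain rfl : j = m + 1 + 1 := by omega
      rw [last, h.diffSeq_zero]; rfl
    rcases j with _ | j
    · obtain rfl : i = m + 1 := by omega
      rw [last, h.diffSeq_zero]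
    rw [h.diffSeq_succ_succ, h.diffSeq_succ_succ, ih (i := i + 1) (j := j) (by omega),
      ih (i := i) (j := j + 1) (by omega)]
    obtain rfl : m = i + j := by omega
    push_cast
    ring

theorem choose_le_diffSeq (h : IsEulerian α a) (hα : 1 ≤ α) {m k : ℕ} (hk : 2 * k < m + 1) :
    ((m + 1).choose k : ℤ) ≤ diffSeq (a m) k := by
  induction m generalizing k with
  | zero =>
    obtain rfl : k = 0 := by omega
    simp [h.diffSeq_zero]
  | succ m ih =>
    rcases k with _ | k
    · simp [h.diffSeq_zero]
    have hα' : (1 : ℤ) ≤ α := by exact_mod_cast hα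
    have hd := ih (k := k) (by omega)
    have hmk : (0 : ℤ) ≤ m + 1 - k := by
      have : k ≤ m + 1 := by omega
      have : (k : ℤ) ≤ m + 1 := by exact_mod_cast this
      linarith
    have hC : (0 : ℤ) ≤ (m + 1).choose k := by positivity
    have hC' : (0 : ℤ) ≤ (m + 1).choose (k + 1) := by positivity
    have hlow : (α * (m + 1 - k : ℤ) + 1) * (m + 1).choose k ≤
        (α * (m + 1 - k : ℤ) + 1) * diffSeq (a m) k :=
      mul_le_mul_of_nonneg_left hd (by positivity)
    rw [h.diffSeq_succ_succ, Nat.choose_succ_succ]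
    push_cast
    rcases (show 2 * (k + 1) ≤ m + 1 by omega).eq_or_lt with he | hlt
    · have hz : diffSeq (a m) (k + 1) = 0 := by
        have := h.diffSeq_antisymm (m := m) (i := k + 1) (j := k + 1) (by omega)
        omega
      have hc : ((m + 1).choose (k + 1) : ℤ) * (k + 1) = (m + 1).choose k * (m + 1 - k) := by
        have := Nat.choose_succ_right_eq (m + 1) k
        zify [show k ≤ m + 1 by omega] at this
        exact this
      have h1 : ((m + 1).choose (k + 1) : ℤ) ≤ (m + 1).choose (k + 1) * (k + 1) := by
        nlinarith [mul_nonneg hC' (Nat.cast_nonneg (α := ℤ) k)]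
      have h2 : (0 : ℤ) ≤ (α - 1) * ((m + 1).choose k * (m + 1 - k)) :=
        mul_nonneg (by linarith) (mul_nonneg hC hmk)
      rw [hz]
      linarith
    · have hd' := ih (k := k + 1) hlt
      have h1 : (0 : ℤ) ≤ α * (k + 1) * diffSeq (a m) (k + 1) :=
        mul_nonneg (by positivity) (hC'.trans hd')
      have h2 : (0 : ℤ) ≤ α * (m + 1 - k) * (m + 1).choose k :=
        mul_nonneg (mul_nonneg (by positivity) hmk) hC
      linarith

/-- Half the sum of an Eulerian row and `±` an alternating binomial row is unimodal. -/
theorem unimodalOn_of_two_mul_eq (h : IsEulerian α a) (hα : 1 ≤ α) {m : ℕ} {f : ℕ → ℕ} (u : ℤˣ)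
    (hf : ∀ k, 2 * (f k : ℤ) = a m k + u * ((-1) ^ k * m.choose k)) : UnimodalOn m f := by
  have hdiff : ∀ k, 2 * ((f (k + 1) : ℤ) - f k) =
      diffSeq (a m) (k + 1) - u * ((-1) ^ k * (m + 1).choose (k + 1)) := by
    intro k
    rw [mul_sub, hf, hf, Nat.choose_succ_succ, diffSeq]
    push_cast
    ring
  have habs : ∀ k, |(u : ℤ) * ((-1) ^ k * (m + 1).choose (k + 1))| = (m + 1).choose (k + 1) := by
    intro k
    rcases Int.units_eq_one_or u with rfl | rfl <;> simp [abs_mul]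
  refine unimodalOn_of_halves (fun k hk ↦ ?_) (fun k hk hkm ↦ ?_)
  · have h1 := h.choose_le_diffSeq hα hk
    have h2 := (abs_le.mp (habs k).le).2
    have h3 := hdiff k
    omega
  · have h1 := h.choose_le_diffSeq hα (m := m) (k := m - k) (by omega)
    rw [h.diffSeq_antisymm (j := k + 1) (by omega),
      Nat.choose_symm_of_eq_add (show m + 1 = m - k + (k + 1) by omega)] at h1
    have h2 := (abs_le.mp (habs k).le).1
    have h3 := hdiff k
    omega

end IsEulerian

/-- Number of points `i` with `R i (σ i)`. -/
def arcCount {n : ℕ} (R : Fin n → Fin n → Prop) [DecidableRel R] (σ : Equiv.Perm (Fin n)) : ℕ :=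
  (Finset.univ.filter fun i ↦ R i (σ i)).card

theorem arcCount_le {n : ℕ} (R : Fin n → Fin n → Prop) [DecidableRel R]
    (σ : Equiv.Perm (Fin n)) : arcCount R σ ≤ n :=
  (Finset.card_le_univ _).trans_eq (Fintype.card_fin n)

section Insertion

variable {n : ℕ} {R : Fin n → Fin n → Prop} {R' : Fin (n + 1) → Fin (n + 1) → Prop}
  [DecidableRel R] [DecidableRel R']

theorem arcCount_decomposeFin_symm_zero (hR : ∀ i j, R' i.succ j.succ ↔ R i j)
    (e : Equiv.Perm (Fin n)) :
    arcCount R' (Equiv.Perm.decomposeFin.symm (0, e)) =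
      arcCount R e + if R' 0 0 then 1 else 0 := by
  simp only [arcCount, Finset.card_filter, Fin.sum_univ_succ]
  simp [hR, add_comm]

/-- Inserting a new point, related to all others in exactly one direction, into the arc
`i → e i` creates one related arc and destroys at most one. -/
theorem arcCount_decomposeFin_symm_succ (hR : ∀ i j, R' i.succ j.succ ↔ R i j)
    (hR0 : ∀ i j : Fin n, R' 0 i.succ ↔ ¬ R' j.succ 0) (e : Equiv.Perm (Fin n)) (i : Fin n) :
    arcCount R' (Equiv.Perm.decomposeFin.symm ((e i).succ, e)) =
      arcCount R e + if R i (e i) then 0 else 1 := by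
  simp only [arcCount, Finset.card_filter, Fin.sum_univ_succ,
    Equiv.Perm.decomposeFin_symm_apply_zero, Equiv.Perm.decomposeFin_symm_apply_succ]
  rw [← Finset.add_sum_erase _ _ (Finset.mem_univ i),
    ← Finset.add_sum_erase _ (fun j ↦ if R j (e j) then 1 else 0) (Finset.mem_univ i)]
  have h : ∀ j ∈ Finset.univ.erase i,
      (if R' j.succ (Equiv.swap 0 (e i).succ (e j).succ) then 1 else 0) =
        if R j (e j) then 1 else 0 := by
    intro j hj
    rw [Equiv.swap_apply_of_ne_of_ne (Fin.succ_ne_zero _) (by simpa using hj)]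
    simp only [hR]
  rw [Finset.sum_congr rfl h, Equiv.swap_apply_right]
  have := hR0 (e i) i
  split_ifs <;> first | omega | tauto

theorem sum_perm_fin_succ (hR : ∀ i j, R' i.succ j.succ ↔ R i j)
    (hR0 : ∀ i j : Fin n, R' 0 i.succ ↔ ¬ R' j.succ 0) (g : ℤˣ → ℕ → ℤ) :
    ∑ σ : Equiv.Perm (Fin (n + 1)), g (Equiv.Perm.sign σ) (arcCount R' σ) =
      ∑ e : Equiv.Perm (Fin n),
        (g (Equiv.Perm.sign e) (arcCount R e + if R' 0 0 then 1 else 0) +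
          arcCount R e * g (-Equiv.Perm.sign e) (arcCount R e) +
          (n - arcCount R e) * g (-Equiv.Perm.sign e) (arcCount R e + 1)) := by
  rw [← Equiv.Perm.decomposeFin.symm.sum_comp, Fintype.sum_prod_type_right]
  refine Finset.sum_congr rfl fun e _ ↦ ?_
  rw [Fin.sum_univ_succ, ← Equiv.sum_comp e]
  simp only [Equiv.Perm.decomposeFin.symm_sign, arcCount_decomposeFin_symm_zero hR,
    arcCount_decomposeFin_symm_succ hR hR0, if_true, one_mul, Fin.succ_ne_zero, if_false, neg_mul,
    add_assoc]
  congr 1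
  have h : ∀ i : Fin n, g (-Equiv.Perm.sign e) (arcCount R e + if R i (e i) then 0 else 1) =
      if R i (e i) then g (-Equiv.Perm.sign e) (arcCount R e)
      else g (-Equiv.Perm.sign e) (arcCount R e + 1) := by
    intro i; split_ifs <;> rfl
  have hn : (Finset.univ.filter fun i ↦ ¬ R i (e i)).card = n - arcCount R e := by
    rw [← Finset.compl_filter, Finset.card_compl, Fintype.card_fin, arcCount]
  rw [Finset.sum_congr rfl fun i _ ↦ h i, Finset.sum_ite, Finset.sum_const, Finset.sum_const, hn,
    nsmul_eq_mul, nsmul_eq_mul, Nat.cast_sub (arcCount_le R e), arcCount]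

end Insertion

/-- The relation whose arcs are counted by the type B excedances: if `δ i` records whether `-(i+1)`
rather than `i+1` is used, and absolute values are listed in decreasing order, an arc `i → j` is
related when it goes up, negative loops being related as well. -/
def signedRel {n : ℕ} (δ : Fin n → Bool) (i j : Fin n) : Prop :=
  if δ i then (δ j → i ≤ j) else (¬ δ j ∧ j < i)

instance {n : ℕ} (δ : Fin n → Bool) : DecidableRel (signedRel δ) := fun _ _ ↦ by
  unfold signedRel; infer_instance

/-- Sum of a function of sign and number of excedances over the symmetric group. -/
def permSum (n : ℕ) (g : ℤˣ → ℕ → ℤ) : ℤ :=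
  ∑ σ : Equiv.Perm (Fin n), g (Equiv.Perm.sign σ) (arcCount (· < ·) σ)

/-- Sum of a function of sign and number of `signedRel` arcs over the hyperoctahedral group. -/
def signedPermSum (n : ℕ) (g : ℤˣ → ℕ → ℤ) : ℤ :=
  ∑ δ : Fin n → Bool, ∑ σ : Equiv.Perm (Fin n),
    g (Equiv.Perm.sign σ * ∏ i, if δ i then -1 else 1) (arcCount (signedRel δ) σ)

theorem permSum_succ (n : ℕ) (g : ℤˣ → ℕ → ℤ) :
    permSum (n + 1) g =
      permSum n fun s x ↦ g s x + x * g (-s) x + (n - x) * g (-s) (x + 1) := by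
  rw [permSum, sum_perm_fin_succ (R := (· < ·)) (fun i j ↦ Fin.succ_lt_succ_iff) (by simp)]
  simp [permSum]

theorem signedPermSum_succ (n : ℕ) (g : ℤˣ → ℕ → ℤ) :
    signedPermSum (n + 1) g =
      signedPermSum n fun s x ↦
        (g s x + x * g (-s) x + (n - x) * g (-s) (x + 1)) +
        (g (-s) (x + 1) + x * g s x + (n - x) * g s (x + 1)) := by
  rw [signedPermSum, ← (Fin.consEquiv fun _ ↦ Bool).sum_comp, Fintype.sum_prod_type_right,
    signedPermSum]
  refine Finset.sum_congr rfl fun δ _ ↦ ?_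
  have hsucc : ∀ b i j, signedRel (Fin.cons b δ : Fin (n + 1) → Bool) (Fin.succ i) (Fin.succ j) ↔
      signedRel δ i j := by
    simp [signedRel]
  have hzero : ∀ b (i j : Fin n), signedRel (Fin.cons b δ : Fin (n + 1) → Bool) 0 (Fin.succ i) ↔
      ¬ signedRel (Fin.cons b δ : Fin (n + 1) → Bool) (Fin.succ j) 0 := by
    intro b i j
    cases b <;> simp [signedRel]
  have hloop : ∀ b, signedRel (Fin.cons b δ : Fin (n + 1) → Bool) 0 0 ↔ b = true := by
    intro b
    cases b <;> simp [signedRel]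
  have key : ∀ b, ∑ σ : Equiv.Perm (Fin (n + 1)),
      g (Equiv.Perm.sign σ * ∏ i, if (Fin.cons b δ : Fin (n + 1) → Bool) i then -1 else 1)
        (arcCount (signedRel (Fin.cons b δ : Fin (n + 1) → Bool)) σ) = _ := fun b ↦
    sum_perm_fin_succ (hsucc b) (hzero b) fun s x ↦
      g (s * ∏ i, if (Fin.cons b δ : Fin (n + 1) → Bool) i then -1 else 1) x
  rw [Fintype.sum_bool, add_comm]
  refine (congrArg₂ (· + ·) (key _) (key _)).trans ?_
  rw [← Finset.sum_add_distrib]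
  refine Finset.sum_congr rfl fun e _ ↦ ?_
  simp [hloop, Fin.prod_univ_succ]

theorem isEulerian_permSum :
    IsEulerian 1 fun m k ↦ permSum (m + 1) fun _ x ↦ if x = k then 1 else 0 := by
  refine ⟨fun k ↦ ?_, fun m ↦ ?_, fun m k ↦ ?_⟩
  · rw [permSum_succ]
    simp [permSum, arcCount, eq_comm]
  · rw [permSum_succ]
    congr 1
    ext s x
    by_cases hx : x = 0 <;> simp [hx]
  · rw [permSum_succ, permSum, permSum, permSum, Finset.mul_sum, Finset.mul_sum,
      ← Finset.sum_add_distrib]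
    refine Finset.sum_congr rfl fun σ _ ↦ ?_
    generalize arcCount (· < ·) σ = x
    by_cases h1 : x = k + 1
    · simp [h1]
      ring
    · by_cases h2 : x = k
      · simp [h2]; ring
      · simp [h1, h2]

theorem isEulerian_signedPermSum :
    IsEulerian 2 fun m k ↦ signedPermSum m fun _ x ↦ if x = k then 1 else 0 := by
  refine ⟨fun k ↦ ?_, fun m ↦ ?_, fun m k ↦ ?_⟩
  · simp [signedPermSum, arcCount, eq_comm]
  · rw [signedPermSum_succ]
    congr 1
    ext s x
    by_cases hx : x = 0 <;> simp [hx]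
  · rw [signedPermSum_succ]
    simp only [signedPermSum, Finset.mul_sum, ← Finset.sum_add_distrib]
    refine Finset.sum_congr rfl fun δ _ ↦ Finset.sum_congr rfl fun σ _ ↦ ?_
    generalize arcCount (signedRel δ) σ = x
    by_cases h1 : x = k + 1
    · simp [h1]
      ring
    · by_cases h2 : x = k
      · simp [h2]; ring
      · simp [h1, h2]

theorem permSum_sign (m k : ℕ) :
    permSum (m + 1) (fun s x ↦ if x = k then (s : ℤ) else 0) = (-1) ^ k * m.choose k := by
  induction m generalizing k with
  | zero => cases k <;> simp [permSum, arcCount]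
  | succ m ih =>
    cases k with
    | zero =>
      have := ih 0
      rw [permSum_succ]
      simp only [pow_zero, Nat.choose_zero_right, Nat.cast_one, mul_one] at this ⊢
      rw [← this]
      congr 1
      ext s x
      by_cases hx : x = 0 <;> simp [hx]
    | succ k =>
      have h : permSum (m + 1 + 1) (fun s x ↦ if x = k + 1 then (s : ℤ) else 0) =
          -k * permSum (m + 1) (fun s x ↦ if x = k + 1 then (s : ℤ) else 0) -
          (m + 1 - k) * permSum (m + 1) (fun s x ↦ if x = k then (s : ℤ) else 0) := by
        rw [permSum_succ, permSum, permSum, permSum, Finset.mul_sum, Finset.mul_sum,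
          ← Finset.sum_sub_distrib]
        refine Finset.sum_congr rfl fun σ _ ↦ ?_
        generalize arcCount (· < ·) σ = x
        by_cases h1 : x = k + 1
        · simp [h1]
          ring
        · by_cases h2 : x = k
          · simp [h2]
          · simp [h1, h2]
      have hc : (m.choose (k + 1) : ℤ) * (k + 1) = m.choose k * (m - k) := by
        rcases le_or_gt k m with hk | hk
        · have := Nat.choose_succ_right_eq m k
          zify [hk] at this
          exact this
        · simp [Nat.choose_eq_zero_of_lt hk, Nat.choose_eq_zero_of_lt (hk.trans k.lt_succ_self)]
      rw [h, ih, ih, Nat.choose_succ_succ, pow_succ]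
      push_cast
      linear_combination (-1) ^ k * hc

theorem signedPermSum_sign (m k : ℕ) :
    signedPermSum m (fun s x ↦ if x = k then (s : ℤ) else 0) = (-1) ^ k * m.choose k := by
  induction m generalizing k with
  | zero => cases k <;> simp [signedPermSum, arcCount]
  | succ m ih =>
    cases k with
    | zero =>
      have := ih 0
      rw [signedPermSum_succ]
      simp only [pow_zero, Nat.choose_zero_right, Nat.cast_one, mul_one] at this ⊢
      rw [← this]
      congr 1
      ext s x
      by_cases hx : x = 0 <;> simp [hx]
    | succ k =>
      have h : signedPermSum (m + 1) (fun s x ↦ if x = k + 1 then (s : ℤ) else 0) =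
          signedPermSum m (fun s x ↦ if x = k + 1 then (s : ℤ) else 0) -
          signedPermSum m (fun s x ↦ if x = k then (s : ℤ) else 0) := by
        rw [signedPermSum_succ]
        simp only [signedPermSum, ← Finset.sum_sub_distrib]
        refine Finset.sum_congr rfl fun δ _ ↦ Finset.sum_congr rfl fun σ _ ↦ ?_
        generalize arcCount (signedRel δ) σ = x
        by_cases h1 : x = k + 1
        · simp [h1]
        · by_cases h2 : x = k
          · simp [h2]
          · simp [h1, h2]
      rw [h, ih, ih, Nat.choose_succ_succ, pow_succ]
      push_cast
      ring

theorem two_mul_card_filter {ι : Type*} [Fintype ι] (s : ι → ℤˣ) (x : ι → ℕ) (u : ℤˣ) (k : ℕ) :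
    2 * ((Finset.univ.filter fun i ↦ s i = u ∧ x i = k).card : ℤ) =
      (∑ i, if x i = k then 1 else 0) + u * ∑ i, if x i = k then (s i : ℤ) else 0 := by
  rw [Finset.card_filter, Nat.cast_sum, Finset.mul_sum, Finset.mul_sum, ← Finset.sum_add_distrib]
  refine Finset.sum_congr rfl fun i _ ↦ ?_
  rcases Int.units_eq_one_or u with rfl | rfl <;>
    rcases Int.units_eq_one_or (s i) with h | h <;> simp [h] <;> split_ifs <;> rfl

theorem unimodalOn_card_perm (m : ℕ) (u : ℤˣ) :
    UnimodalOn m fun k ↦ (Finset.univ.filter fun σ : Equiv.Perm (Fin (m + 1)) ↦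
      Equiv.Perm.sign σ = u ∧ excA σ = k).card := by
  refine isEulerian_permSum.unimodalOn_of_two_mul_eq le_rfl u fun k ↦ ?_
  rw [two_mul_card_filter, ← permSum_sign]
  rfl

theorem neg_one_pow_invB {n : ℕ} (p : SignedPerm n) :
    (-1 : ℤˣ) ^ invB p = Equiv.Perm.sign p.1 * ∏ i, if p.2 i then -1 else 1 := by
  have hneg : (Finset.univ.filter fun i ↦ valB p i < 0) = Finset.univ.filter fun i ↦ p.2 i := by
    ext i
    rw [Finset.mem_filter_univ, Finset.mem_filter_univ, valB]
    cases p.2 i <;> simp <;> omega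
  have hprod : ∀ q : Fin n × Fin n → Prop, [DecidablePred q] →
      (-1 : ℤˣ) ^ (Finset.univ.filter fun ij : Fin n × Fin n ↦ ij.1 < ij.2 ∧ q ij).card =
        ∏ i, ∏ j ∈ Finset.Ioi i, if q (i, j) then -1 else 1 := by
    intro q _
    rw [← Finset.prod_const, Finset.prod_filter, Fintype.prod_prod_type]
    refine Finset.prod_congr rfl fun i _ ↦ ?_
    rw [← Finset.filter_lt_eq_Ioi, Finset.prod_filter]
    refine Finset.prod_congr rfl fun j _ ↦ ?_
    by_cases h : i < j <;> simp [h]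
  rw [invB, pow_add, pow_add, hneg, hprod, hprod, Equiv.Perm.sign_eq_prod_prod_Ioi,
    ← Finset.prod_const, Finset.prod_filter, ← Finset.prod_mul_distrib]
  congr 1
  refine Finset.prod_congr rfl fun i _ ↦ ?_
  rw [← Finset.prod_mul_distrib]
  refine Finset.prod_congr rfl fun j hj ↦ ?_
  have hne : (p.1 i : ℕ) ≠ p.1 j := by
    simpa [Fin.val_inj] using (Finset.mem_Ioi.mp hj).ne
  simp only [valB, Fin.lt_def]
  split_ifs <;> first | rfl | omega

/-- Record a signed permutation by the permutation of absolute values and the signs of the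
values, both with absolute values listed in decreasing order. -/
def signedPermRevEquiv (n : ℕ) : SignedPerm n ≃ Equiv.Perm (Fin n) × (Fin n → Bool) where
  toFun p := (Fin.revPerm * p.1 * Fin.revPerm, fun i ↦ p.2 (p.1.symm i.rev))
  invFun q := (Fin.revPerm * q.1 * Fin.revPerm, fun i ↦ q.2 (q.1 i.rev))
  left_inv p := by ext i <;> simp
  right_inv q := by
    ext i
    · simp
    · simp [Equiv.Perm.mul_def]

theorem excB_eq_arcCount {n : ℕ} (p : SignedPerm n) :
    excB p = arcCount (signedRel (signedPermRevEquiv n p).2) (signedPermRevEquiv n p).1 := by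
  have happ : ∀ i, appB p |valB p i| = valB p (p.1 i) := by
    intro i
    have habs : |valB p i| = (p.1 i : ℤ) + 1 := by
      rw [valB]
      split_ifs
      · rw [abs_neg]; exact abs_of_nonneg (by positivity)
      · exact abs_of_nonneg (by positivity)
    have hlt := (p.1 i).isLt
    rw [habs, appB, dif_pos (by omega)]
    congr 1
  rw [excB, ← Finset.card_union_of_disjoint, arcCount]
  · refine Finset.card_equiv (p.1.trans Fin.revPerm) fun i ↦ ?_
    simp only [Finset.mem_union, Finset.mem_filter, Finset.mem_univ, true_and, happ, signedRel,
      signedPermRevEquiv, Equiv.coe_fn_mk, Equiv.trans_apply, Fin.revPerm_apply, Fin.rev_rev,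
      Equiv.symm_apply_apply, Equiv.Perm.mul_apply, Fin.rev_le_rev, Fin.rev_lt_rev]
    have hfix : (p.1 (p.1 i) : ℕ) = p.1 i ↔ p.1 i = i := by
      rw [Fin.val_inj, p.1.injective.eq_iff]
    have hval : p.1 i = i ↔ (p.1 i : ℕ) = i := Fin.ext_iff
    by_cases h : p.1 i = i
    · rw [h]
      simp only [valB, h, Fin.le_def, Fin.lt_def]
      cases p.2 i
      · simp; omega
      · simp
    · rw [hval] at hfix h
      simp only [valB, Fin.le_def, Fin.lt_def]
      cases p.2 i <;> cases p.2 (p.1 i) <;> simp <;> omega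
  · rw [Finset.disjoint_filter]
    intro i _ h1 h2
    have hi : p.1 i = i := by
      ext
      rw [valB] at h2
      split_ifs at h2 <;> omega
    rw [happ, hi] at h1
    exact lt_irrefl _ h1

theorem sum_signedPerm (n : ℕ) (g : ℤˣ → ℕ → ℤ) :
    ∑ p : SignedPerm n, g ((-1) ^ invB p) (excB p) = signedPermSum n g := by
  rw [signedPermSum, ← Fintype.sum_prod_type_right']
  refine Fintype.sum_equiv (signedPermRevEquiv n) _ _ fun p ↦ ?_
  rw [neg_one_pow_invB, excB_eq_arcCount]
  congr 2
  · simp only [signedPermRevEquiv, Equiv.coe_fn_mk, Equiv.Perm.sign_mul]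
    rw [mul_right_comm, Int.units_mul_self, one_mul]
  · exact ((Fin.revPerm.trans p.1.symm).prod_comp fun i ↦ if p.2 i then (-1 : ℤˣ) else 1).symm

theorem unimodalOn_card_signedPerm (m : ℕ) (u : ℤˣ) :
    UnimodalOn m fun k ↦ (Finset.univ.filter fun p : SignedPerm m ↦
      (-1) ^ invB p = u ∧ excB p = k).card := by
  refine isEulerian_signedPermSum.unimodalOn_of_two_mul_eq one_le_two u fun k ↦ ?_
  rw [two_mul_card_filter, ← signedPermSum_sign, ← sum_signedPerm, ← sum_signedPerm]

/-- **Corollary.** For every positive integer `n`, the sequences `(P_{n,k})_{k=0}^{n-1}`,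
`(Q_{n,k})_{k=0}^{n-1}`, `(P^B_{n,k})_{k=0}^{n}` and `(Q^B_{n,k})_{k=0}^{n}` are each
unimodal. -/
theorem excedance_sequences_unimodal (n : ℕ) (hn : 1 ≤ n) :
    UnimodalOn (n - 1) (P n) ∧ UnimodalOn (n - 1) (Q n) ∧
      UnimodalOn n (PB n) ∧ UnimodalOn n (QB n) := by
  obtain ⟨m, rfl⟩ := Nat.exists_eq_add_of_le' hn
  refine ⟨unimodalOn_card_perm m 1, unimodalOn_card_perm m (-1), ?_, ?_⟩
  · convert unimodalOn_card_signedPerm (m + 1) 1 using 1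
    ext k
    simp only [PB, neg_one_pow_eq_one_iff_even (R := ℤˣ) (by decide)]
  · convert unimodalOn_card_signedPerm (m + 1) (-1) using 1
    ext k
    simp only [QB, neg_one_pow_eq_neg_one_iff_odd (R := ℤˣ) (by decide), Nat.not_even_iff_odd]
end

section
/- Let T_{n,k} be the nonnegative integer array defined by T_{1,0} = 1, T_{1,k} = 0 for k ≥ 1, T_{n,k} = 0 for k < 0, and the recurrence T_{n,k} = (k+1)·T_{n-1,k} + (2n−4k)·T_{n-1,k-1} for n ≥ 2 (the gamma coefficients of the Type A Eulerian polynomials). Then for each positive integer n, the sequence k ↦ T_{n,k} is log-concave: T_{n,k}^2 ≥ T_{n,k-1}·T_{n,k+1} for all k ≥ 1. -/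
/-- If `p, q, r, s` is log-concave with `p * s ≤ q * r`, then so are the three terms obtained from
it by a triangular recurrence whose weights are arithmetic progressions of differences `1`, `-4`. -/
theorem mul_le_sq_of_affine_recurrence {p q r s f g : ℤ} (hf : 1 ≤ f) (hg : 4 ≤ g)
    (hq : p * r ≤ q ^ 2) (hr : q * s ≤ r ^ 2) (hqr : p * s ≤ q * r) :
    ((f - 1) * q + (g + 4) * p) * ((f + 1) * s + (g - 4) * r) ≤ (f * r + g * q) ^ 2 := by
  have h1 : 0 ≤ (f - 1) * (f + 1) * (r ^ 2 - q * s) :=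
    mul_nonneg (mul_nonneg (by linarith) (by linarith)) (by linarith)
  have h2 : 0 ≤ (g - 4) * (g + 4) * (q ^ 2 - p * r) :=
    mul_nonneg (mul_nonneg (by linarith) (by linarith)) (by linarith)
  have h3 : 0 ≤ (g + 4) * (f + 1) * (q * r - p * s) :=
    mul_nonneg (mul_nonneg (by linarith) (by linarith)) (by linarith)
  linarith [sq_nonneg (r - 4 * q)]

theorem mul_le_mul_of_log_concave {p q r s : ℤ} (hs : 0 ≤ s) (hq₀ : 0 < q)
    (hr₀ : 0 < r) (hq : p * r ≤ q ^ 2) (hr : q * s ≤ r ^ 2) : p * s ≤ q * r := by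
  have h : (p * r) * (q * s) ≤ q ^ 2 * r ^ 2 :=
    mul_le_mul hq hr (by positivity) (by positivity)
  have hqr : 0 < q * r := mul_pos hq₀ hr₀
  exact le_of_mul_le_mul_right (by linarith) hqr

/-- The support of the array of gamma coefficients. -/
theorem gamma_coefficient_support (T : ℕ → ℤ → ℕ)
    (hT10 : T 1 0 = 1)
    (hT1k : ∀ k : ℤ, 1 ≤ k → T 1 k = 0)
    (hrec : ∀ n : ℕ, 2 ≤ n → ∀ k : ℤ, 0 ≤ k →
      (T n k : ℤ) = (k + 1) * (T (n - 1) k : ℤ) +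
        (2 * (n : ℤ) - 4 * k) * (T (n - 1) (k - 1) : ℤ))
    (n : ℕ) (hn : 1 ≤ n) :
    ∀ k : ℤ, 0 ≤ k → (2 * k < n → 0 < T n k) ∧ (n ≤ 2 * k → T n k = 0) := by
  induction n, hn using Nat.le_induction with
  | base =>
    intro k hk
    refine ⟨fun h => ?_, fun h => hT1k k (by push_cast at h; omega)⟩
    obtain rfl : k = 0 := by push_cast at h; omega
    omega
  | succ n hn ih =>
    intro k hk
    have e := hrec (n + 1) (by omega) k hk
    simp only [Nat.add_sub_cancel] at e
    push_cast at e ⊢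
    constructor
    · intro h
      zify
      rw [e]
      rcases lt_or_ge (2 * k) n with h' | h'
      · have hpos : (0 : ℤ) < T n k := by exact_mod_cast (ih k hk).1 h'
        have : 0 ≤ (2 * ((n : ℤ) + 1) - 4 * k) * (T n (k - 1) : ℤ) :=
          mul_nonneg (by linarith) (by positivity)
        positivity
      · have hpos : (0 : ℤ) < T n (k - 1) := by
          exact_mod_cast (ih (k - 1) (by omega)).1 (by omega)
        have : 0 < (2 * ((n : ℤ) + 1) - 4 * k) * (T n (k - 1) : ℤ) :=
          mul_pos (by linarith) hpos
        positivity
    · intro h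
      zify
      rw [e, (ih k hk).2 (by omega)]
      rcases eq_or_lt_of_le h with h' | h'
      · rw [show 2 * ((n : ℤ) + 1) - 4 * k = 0 by linarith]
        simp
      · rw [(ih (k - 1) (by omega)).2 (by omega)]
        simp


/-- **Log-concavity of the gamma coefficients of the Type A Eulerian polynomials.**
Let `T n k` (indexed by `n : ℕ`, `k : ℤ`) be the nonnegative integer array with
`T 1 0 = 1`, `T 1 k = 0` for `k ≥ 1`, `T n k = 0` for `k < 0`, and
`T n k = (k+1)·T (n-1) k + (2n−4k)·T (n-1) (k-1)` for `n ≥ 2` and `k ≥ 0`.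
Then for each `n ≥ 1`, the sequence `k ↦ T n k` is log-concave:
`T_{n,k}² ≥ T_{n,k-1} · T_{n,k+1}` for all `k ≥ 1`. -/
theorem typeA_gamma_coefficients_log_concave (T : ℕ → ℤ → ℕ)
    (hT10 : T 1 0 = 1)
    (hT1k : ∀ k : ℤ, 1 ≤ k → T 1 k = 0)
    (hTneg : ∀ n : ℕ, ∀ k : ℤ, k < 0 → T n k = 0)
    (hrec : ∀ n : ℕ, 2 ≤ n → ∀ k : ℤ, 0 ≤ k →
      (T n k : ℤ) = (k + 1) * (T (n - 1) k : ℤ) +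
        (2 * (n : ℤ) - 4 * k) * (T (n - 1) (k - 1) : ℤ)) :
    ∀ n : ℕ, 1 ≤ n → ∀ k : ℤ, 1 ≤ k →
      (T n k) ^ 2 ≥ T n (k - 1) * T n (k + 1) := by
  intro n hn
  have supp := gamma_coefficient_support T hT10 hT1k hrec
  induction n, hn using Nat.le_induction with
  | base =>
    intro k hk
    simp [hT1k (k + 1) (by omega)]
  | succ n hn ih =>
    intro k hk
    rcases le_or_gt ((n : ℤ) + 1) (2 * (k + 1)) with h | h
    · simp [(supp (n + 1) (by omega) (k + 1) (by omega)).2 (by push_cast; exact h)]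
    have e₀ := hrec (n + 1) (by omega) (k - 1) (by omega)
    have e₁ := hrec (n + 1) (by omega) k (by omega)
    have e₂ := hrec (n + 1) (by omega) (k + 1) (by omega)
    simp only [Nat.add_sub_cancel, add_sub_cancel_right] at e₀ e₁ e₂
    have hr : (T n (k - 1) : ℤ) * T n (k + 1) ≤ (T n k : ℤ) ^ 2 := by exact_mod_cast ih k hk
    have hq : (T n (k - 1 - 1) : ℤ) * T n k ≤ (T n (k - 1) : ℤ) ^ 2 := by
      rcases eq_or_lt_of_le hk with rfl | hk'
      · rw [hTneg n (1 - 1 - 1) (by norm_num), Nat.cast_zero, zero_mul]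
        positivity
      · have := ih (k - 1) (by omega)
        rw [sub_add_cancel] at this
        exact_mod_cast this
    have hq₀ : (0 : ℤ) < T n (k - 1) := by
      exact_mod_cast (supp n hn (k - 1) (by omega)).1 (by omega)
    have hr₀ : (0 : ℤ) < T n k := by exact_mod_cast (supp n hn k (by omega)).1 (by omega)
    have key := mul_le_sq_of_affine_recurrence (f := k + 1) (g := 2 * ((n : ℤ) + 1) - 4 * k)
      (by omega) (by omega) hq hr
      (mul_le_mul_of_log_concave (by positivity) hq₀ hr₀ hq hr)
    zify
    rw [e₀, e₁, e₂]
    push_cast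
    linarith
end

section
/- Let R_{n,k} be the nonnegative integer array defined by R_{1,0} = 1, R_{1,k} = 0 for k ≥ 1, R_{n,k} = 0 for k < 0, and the recurrence R_{n,k} = (2k+1)·R_{n-1,k} + 4(n+1−2k)·R_{n-1,k-1} for n ≥ 2 (the gamma coefficients of the Type B Eulerian polynomials). Then for each positive integer n, the sequence k ↦ R_{n,k} is log-concave: R_{n,k}^2 ≥ R_{n,k-1}·R_{n,k+1} for all k ≥ 1. -/
/-- One step of a triangular recurrence with coefficients linear in the column index:
`a, b, c, d` are consecutive entries of a row, `p, q` the coefficients of the middle column. -/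
lemma mul_le_sq_of_linear_recurrence {a b c d p q : ℤ} (hb : 0 < b) (hc : 0 < c)
    (hp : 2 ≤ p) (hq : 8 ≤ q) (ha : 0 ≤ a) (hac : a * c ≤ b ^ 2) (hbd : b * d ≤ c ^ 2) :
    ((p - 2) * b + (q + 8) * a) * ((p + 2) * d + (q - 8) * c) ≤ (p * c + q * b) ^ 2 := by
  have had : a * d ≤ b * c := by
    refine le_of_mul_le_mul_right ?_ (mul_pos hb hc)
    nlinarith [mul_le_mul_of_nonneg_left hbd (mul_nonneg ha hc.le),
      mul_le_mul_of_nonneg_right hac (sq_nonneg c)]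
  have h₁ : (p ^ 2 - 4) * (b * d) ≤ (p ^ 2 - 4) * c ^ 2 :=
    mul_le_mul_of_nonneg_left hbd (by nlinarith)
  have h₂ : (q ^ 2 - 64) * (a * c) ≤ (q ^ 2 - 64) * b ^ 2 :=
    mul_le_mul_of_nonneg_left hac (by nlinarith)
  have h₃ : (q + 8) * (p + 2) * (a * d) ≤ (q + 8) * (p + 2) * (b * c) :=
    mul_le_mul_of_nonneg_left had (by positivity)
  linear_combination h₁ + h₂ + h₃ + 4 * sq_nonneg (c - 4 * b)


/-- **Log-concavity of the gamma coefficients of the Type B Eulerian polynomials.**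
Let `R n k` (indexed by `n : ℕ`, `k : ℤ`) be the nonnegative integer array with
`R 1 0 = 1`, `R 1 k = 0` for `k ≥ 1`, `R n k = 0` for `k < 0`, and
`R n k = (2k+1)·R (n-1) k + 4(n+1−2k)·R (n-1) (k-1)` for `n ≥ 2` and `k ≥ 0`.
Then for each `n ≥ 1`, the sequence `k ↦ R n k` is log-concave:
`R_{n,k}² ≥ R_{n,k-1} · R_{n,k+1}` for all `k ≥ 1`. -/
theorem typeB_gamma_coefficients_log_concave (R : ℕ → ℤ → ℕ)
    (hR10 : R 1 0 = 1)
    (hR1k : ∀ k : ℤ, 1 ≤ k → R 1 k = 0)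
    (hRneg : ∀ n : ℕ, ∀ k : ℤ, k < 0 → R n k = 0)
    (hrec : ∀ n : ℕ, 2 ≤ n → ∀ k : ℤ, 0 ≤ k →
      (R n k : ℤ) = (2 * k + 1) * (R (n - 1) k : ℤ) +
        4 * ((n : ℤ) + 1 - 2 * k) * (R (n - 1) (k - 1) : ℤ)) :
    ∀ n : ℕ, 1 ≤ n → ∀ k : ℤ, 1 ≤ k →
      (R n k) ^ 2 ≥ R n (k - 1) * R n (k + 1) := by
  have zero : ∀ n : ℕ, 1 ≤ n → ∀ k : ℤ, (n : ℤ) < 2 * k → R n k = 0 := by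
    intro n hn
    induction n, hn using Nat.le_induction with
    | base => exact fun k hk => hR1k k (by omega)
    | succ n hn ih =>
      intro k hk
      push_cast at hk
      have h := hrec (n + 1) (by omega) k (by omega)
      rw [Nat.add_sub_cancel, ih k (by omega)] at h
      push_cast at h
      rcases eq_or_ne (2 * k) (n + 2) with hk' | hk'
      · have hcoef : (n : ℤ) + 1 + 1 - 2 * k = 0 := by omega
        simpa [hcoef] using h
      · rw [ih (k - 1) (by omega)] at h
        simpa using h
  have pos : ∀ n : ℕ, 1 ≤ n → ∀ k : ℤ, 0 ≤ k → 2 * k ≤ n → 0 < R n k := by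
    intro n hn
    induction n, hn using Nat.le_induction with
    | base =>
      intro k hk hk'
      obtain rfl : k = 0 := by omega
      omega
    | succ n hn ih =>
      intro k hk hk'
      push_cast at hk'
      have h := hrec (n + 1) (by omega) k hk
      rw [Nat.add_sub_cancel] at h
      push_cast at h
      have hcoef : (0 : ℤ) < n + 1 + 1 - 2 * k := by omega
      suffices (0 : ℤ) < R (n + 1) k by exact_mod_cast this
      rw [h]
      rcases hk.eq_or_lt with rfl | hk₀
      · have := ih 0 le_rfl (by omega)
        positivity
      · have := ih (k - 1) (by omega) (by omega)
        positivity
  intro n hn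
  induction n, hn using Nat.le_induction with
  | base =>
    intro k hk
    simp [hR1k (k + 1) (by omega)]
  | succ n hn ih =>
    intro k hk
    by_cases hkn : (n : ℤ) + 1 < 2 * (k + 1)
    · simp [zero (n + 1) (by omega) (k + 1) (by push_cast; exact hkn)]
    have h₀ := hrec (n + 1) (by omega) k (by omega)
    have h₁ := hrec (n + 1) (by omega) (k - 1) (by omega)
    have h₂ := hrec (n + 1) (by omega) (k + 1) (by omega)
    rw [Nat.add_sub_cancel] at h₀ h₁ h₂
    rw [add_sub_cancel_right] at h₂
    have hbd := ih k hk
    have hac : R n (k - 1 - 1) * R n k ≤ R n (k - 1) ^ 2 := by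
      rcases hk.eq_or_lt with rfl | hk₁
      · simp [hRneg n (-1) (by norm_num)]
      · simpa using ih (k - 1) (by omega)
    have key := mul_le_sq_of_linear_recurrence (p := 2 * k + 1) (q := 4 * ((n : ℤ) + 2 - 2 * k))
      (a := R n (k - 1 - 1)) (b := R n (k - 1)) (c := R n k) (d := R n (k + 1))
      (by exact_mod_cast pos n hn (k - 1) (by omega) (by omega))
      (by exact_mod_cast pos n hn k (by omega) (by omega))
      (by omega) (by omega) (by positivity) (by exact_mod_cast hac) (by exact_mod_cast hbd)
    zify
    rw [h₀, h₁, h₂]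
    push_cast
    linear_combination key
end
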